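/- arXiv:math/0511373 — 11 statements merged into one kernel-verified Lean document; each statement's English description precedes it below -/
import Mathlib

section
/- Let n ≥ 1 and let A ⊆ ℕⁿ be a finite set with variety {0}. Suppose B ⊆ A has exactly n elements whose associated n×n matrix (with the elements of B as columns, viewed in ℝ) has nonzero determinant, and suppose ρ ∈ ℝⁿ with all coordinates ≥ 0, ρ ≠ 0, and c ∈ ℝ satisfy ρ·b = c for all b ∈ B and ρ·a ≥ c for all a ∈ A. Then ρᵢ > 0 for every i, and c > 0. (In particular, every essential subset of A lies in a compact facet of the Newton polyhedron, i.e. on the Newton diagram.) -/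
/-- `A ⊆ ℕⁿ` has variety `{0}`: `0 ∉ A` and `A` meets every coordinate axis. -/
def hasVarietyZero (n : ℕ) (A : Finset (Fin n →₀ ℕ)) : Prop :=
  (0 : Fin n →₀ ℕ) ∉ A ∧ ∀ i : Fin n, ∃ k : ℕ, 1 ≤ k ∧ Finsupp.single i k ∈ A

/-- if `B ⊆ A` has `n` linearly independent elements lying in a face of the
Newton polyhedron with normal `ρ ≥ 0`, `ρ ≠ 0`, supporting value `c`, then `ρ` has all
coordinates strictly positive and `c > 0`. -/
theorem stmt2 (n : ℕ) (hn : 1 ≤ n) (A : Finset (Fin n →₀ ℕ)) (hA : hasVarietyZero n A)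
    (B : Finset (Fin n →₀ ℕ)) (hBA : B ⊆ A) (hcard : B.card = n)
    (hind : LinearIndependent ℝ (fun b : B => fun i : Fin n => ((b : Fin n →₀ ℕ) i : ℝ)))
    (ρ : Fin n → ℝ) (hρnn : ∀ i, 0 ≤ ρ i) (hρ0 : ρ ≠ 0) (c : ℝ)
    (hB : ∀ b ∈ B, ∑ i, ρ i * (b i : ℝ) = c)
    (hA' : ∀ a ∈ A, c ≤ ∑ i, ρ i * (a i : ℝ)) :
    (∀ i, 0 < ρ i) ∧ 0 < c := by
  have hc : 0 < c := by
    have : Nonempty B := (Finset.card_pos.mp (hcard.symm ▸ hn)).to_subtype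
    obtain ⟨b, hb⟩ := this
    have hc0 : 0 ≤ c := hB b hb ▸
      Finset.sum_nonneg fun i _ => mul_nonneg (hρnn i) (Nat.cast_nonneg _)
    refine hc0.lt_of_ne' fun hc => hρ0 ?_
    have hspan := hind.span_eq_top_of_card_eq_finrank' (by simp [hcard])
    have hdot : dotProductBilin ℝ ℝ ρ = 0 := by
      refine LinearMap.ext_on hspan ?_
      rintro _ ⟨b, rfl⟩
      simpa [dotProduct, hc] using hB b b.2
    exact dotProduct_self_eq_zero.mp (LinearMap.congr_fun hdot ρ)
  refine ⟨fun i => (hρnn i).lt_of_ne' fun hi => ?_, hc⟩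
  obtain ⟨k, -, hk⟩ := hA.2 i
  have h := hA' _ hk
  simp [Finsupp.single_apply, hi] at h
  exact absurd h hc.not_ge
end

section
/- Let n ≥ 1, let A ⊆ ℕⁿ be finite and nonempty, and let b ∈ ℝⁿ with b ∈ Γ⁺(A). Then for every z ∈ ℂⁿ with |zᵢ| ≤ 1 for all i, one has ∏ᵢ₌₁ⁿ |zᵢ|^{bᵢ} ≤ Σ_{a∈A} ∏ᵢ₌₁ⁿ |zᵢ|^{aᵢ} (real powers, with the convention 0⁰ = 1). -/
open Pointwise

/-- The Newton polyhedron `Γ⁺(A) = convexHull(A) + ℝ≥0ⁿ` of a finite `A ⊆ ℕⁿ`. -/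
noncomputable def newtonPolyhedron (n : ℕ) (A : Finset (Fin n →₀ ℕ)) : Set (Fin n → ℝ) :=
  convexHull ℝ ((fun a : Fin n →₀ ℕ => fun i : Fin n => (a i : ℝ)) '' (A : Set (Fin n →₀ ℕ))) +
    {r : Fin n → ℝ | ∀ i, 0 ≤ r i}

theorem convexOn_prod_rpow {ι : Type*} [Fintype ι] {t : ι → ℝ} (ht : ∀ i, 0 ≤ t i) :
    ConvexOn ℝ {β : ι → ℝ | ∀ i, 0 ≤ β i} fun β => ∏ i, t i ^ β i := by
  refine ⟨convex_Ici (𝕜 := ℝ) (0 : ι → ℝ), fun β hβ γ hγ u v hu hv huv => ?_⟩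
  have hfactor : ∏ i, t i ^ (u • β + v • γ) i = (∏ i, t i ^ β i) ^ u * (∏ i, t i ^ γ i) ^ v := by
    rw [← Real.finsetProd_rpow _ _ fun i _ => Real.rpow_nonneg (ht i) _,
      ← Real.finsetProd_rpow _ _ fun i _ => Real.rpow_nonneg (ht i) _, ← Finset.prod_mul_distrib]
    refine Finset.prod_congr rfl fun i _ => ?_
    rw [← Real.rpow_mul (ht i), ← Real.rpow_mul (ht i), ← Real.rpow_add_of_nonneg (ht i)
      (mul_nonneg (hβ i) hu) (mul_nonneg (hγ i) hv)]
    simp [mul_comm]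
  simp only [hfactor, smul_eq_mul]
  exact Real.geom_mean_le_arith_mean2_weighted hu hv
    (Finset.prod_nonneg fun i _ => Real.rpow_nonneg (ht i) _)
    (Finset.prod_nonneg fun i _ => Real.rpow_nonneg (ht i) _) huv

/-- if `b ∈ Γ⁺(A)` then `∏ |zᵢ|^{bᵢ} ≤ Σ_{a∈A} ∏ |zᵢ|^{aᵢ}` whenever all
`|zᵢ| ≤ 1` (real powers, `0⁰ = 1`). -/
theorem stmt3 (n : ℕ) (hn : 1 ≤ n) (A : Finset (Fin n →₀ ℕ)) (hA : A.Nonempty)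
    (b : Fin n → ℝ) (hb : b ∈ newtonPolyhedron n A) (z : Fin n → ℂ)
    (hz : ∀ i, ‖z i‖ ≤ 1) :
    (∏ i, ‖z i‖ ^ (b i)) ≤ ∑ a ∈ A, ∏ i, ‖z i‖ ^ ((a i : ℝ)) := by
  obtain ⟨β, hβ, r, hr, rfl⟩ := hb
  obtain ⟨hβ_nonneg, hβ_le⟩ := convexHull_min (by
    rintro _ ⟨a, ha, rfl⟩
    exact ⟨fun i => Nat.cast_nonneg _, Finset.single_le_sum
      (f := fun a : Fin n →₀ ℕ => ∏ i, ‖z i‖ ^ (a i : ℝ))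
      (fun a _ => Finset.prod_nonneg fun i _ => Real.rpow_nonneg (norm_nonneg _) _) ha⟩)
    ((convexOn_prod_rpow fun i => norm_nonneg (z i)).convex_le
      (∑ a ∈ A, ∏ i, ‖z i‖ ^ (a i : ℝ))) hβ
  refine le_trans (Finset.prod_le_prod (fun i _ => Real.rpow_nonneg (norm_nonneg _) _)
    fun i _ => ?_) hβ_le
  exact Real.rpow_le_rpow_of_exponent_ge' (norm_nonneg _) (hz i) (hβ_nonneg i)
    (le_add_of_nonneg_right (hr i))
end

section
/- Let n ≥ 1, let A ⊆ ℕⁿ be finite and nonempty, and let b ∈ ℝⁿ have all coordinates ≥ 0 with b ∉ Γ⁺(A). Then for every C > 0 and every ε > 0 there exists z ∈ ℂⁿ with 0 < |zᵢ| < ε for all i such that ∏ᵢ |zᵢ|^{bᵢ} > C · Σ_{a∈A} ∏ᵢ |zᵢ|^{aᵢ}. In particular, there is no constant C and no neighborhood of 0 in ℂⁿ on which the inequality ∏ᵢ|zᵢ|^{bᵢ} ≤ C Σ_{a∈A}∏ᵢ|zᵢ|^{aᵢ} holds. -/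
open Pointwise

lemma exponent_add_mem_newtonPolyhedron {n : ℕ} {A : Finset (Fin n →₀ ℕ)} {a : Fin n →₀ ℕ}
    (ha : a ∈ A) {r : Fin n → ℝ} (hr : ∀ i, 0 ≤ r i) :
    (fun i => (a i : ℝ)) + r ∈ newtonPolyhedron n A :=
  Set.add_mem_add (subset_convexHull ℝ _ ⟨a, ha, rfl⟩) hr

/-- A continuous linear functional that is bounded below on a nonempty Newton polyhedron is
nonnegative on the coordinate vectors. -/
lemma newtonPolyhedron_functional_single_nonneg {n : ℕ} {A : Finset (Fin n →₀ ℕ)}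
    {f : (Fin n → ℝ) →L[ℝ] ℝ} {u : ℝ} (hf : ∀ y ∈ newtonPolyhedron n A, u < f y)
    (hA : A.Nonempty) (i : Fin n) : 0 ≤ f (Pi.single i 1) := by
  obtain ⟨a, ha⟩ := hA
  by_contra! hneg
  set p : Fin n → ℝ := fun j => (a j : ℝ)
  set s : ℝ := |u - f p| / -f (Pi.single i 1)
  have hs : 0 ≤ s := div_nonneg (abs_nonneg _) (by linarith)
  have hmem : p + s • (Pi.single i 1 : Fin n → ℝ) ∈ newtonPolyhedron n A := by
    refine exponent_add_mem_newtonPolyhedron ha fun j => ?_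
    by_cases hj : j = i
    · subst hj; simpa using hs
    · simp [hj]
  have h := hf _ hmem
  have hmul : s * f (Pi.single i 1) = -|u - f p| := by
    simp only [s]
    field_simp [hneg.ne]
  rw [map_add, map_smul, smul_eq_mul, hmul] at h
  linarith [neg_abs_le (u - f p), le_abs_self (u - f p)]

lemma isClosed_newtonPolyhedron (n : ℕ) (A : Finset (Fin n →₀ ℕ)) :
    IsClosed (newtonPolyhedron n A) := by
  refine IsClosed.add_left_of_isCompact ?_ ((A.finite_toSet.image _).isCompact_convexHull ℝ)
  simp only [Set.ofPred_forall]
  exact isClosed_iInter fun i => isClosed_le continuous_const (continuous_apply i)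

lemma convex_newtonPolyhedron (n : ℕ) (A : Finset (Fin n →₀ ℕ)) :
    Convex ℝ (newtonPolyhedron n A) :=
  (convex_convexHull ℝ _).add fun _ hx _ hy _ _ hs ht _ i =>
    add_nonneg (mul_nonneg hs (hx i)) (mul_nonneg ht (hy i))

/-- A point with nonnegative coordinates outside a Newton polyhedron is separated from the
generating exponents by a strictly positive weight. -/
lemma exists_pos_weight_of_notMem_newtonPolyhedron {n : ℕ} {A : Finset (Fin n →₀ ℕ)}
    (hA : A.Nonempty) {b : Fin n → ℝ} (hbnn : ∀ i, 0 ≤ b i) (hb : b ∉ newtonPolyhedron n A) :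
    ∃ w : Fin n → ℝ, (∀ i, 0 < w i) ∧ ∀ a ∈ A, ∑ i, w i * b i < ∑ i, w i * (a i : ℝ) := by
  obtain ⟨f, u, hfb, hf⟩ := geometric_hahn_banach_point_closed
    (convex_newtonPolyhedron n A) (isClosed_newtonPolyhedron n A) hb
  have hf_eq (x : Fin n → ℝ) : f x = ∑ i, f (Pi.single i 1) * x i := by
    conv_lhs => rw [pi_eq_sum_univ' x, map_sum]
    refine Finset.sum_congr rfl fun i _ => ?_
    rw [map_smul, smul_eq_mul, mul_comm]
  have hB : 0 ≤ ∑ i, b i := Finset.sum_nonneg fun i _ => hbnn i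
  set δ : ℝ := (u - f b) / (1 + ∑ i, b i)
  have hδ : 0 < δ := div_pos (by linarith) (by linarith)
  have hδB : δ * (1 + ∑ i, b i) = u - f b := div_mul_cancel₀ _ (by linarith)
  refine ⟨fun i => f (Pi.single i 1) + δ, fun i => add_pos_of_nonneg_of_pos
    (newtonPolyhedron_functional_single_nonneg hf hA i) hδ, fun a ha => ?_⟩
  simp only [add_mul, Finset.sum_add_distrib, ← Finset.mul_sum]
  have hfa : u < f (fun i => (a i : ℝ)) := hf _ <| by
    simpa using exponent_add_mem_newtonPolyhedron ha (r := 0) fun _ => le_rfl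
  have ha_nonneg : 0 ≤ δ * ∑ i, (a i : ℝ) :=
    mul_nonneg hδ.le (Finset.sum_nonneg fun i _ => Nat.cast_nonneg _)
  rw [hf_eq] at hfa
  rw [← hf_eq b]
  linarith

lemma tendsto_rpow_nhdsGT_zero {p : ℝ} (hp : 0 < p) :
    Filter.Tendsto (fun t : ℝ => t ^ p) (nhdsWithin 0 (Set.Ioi 0)) (nhds 0) := by
  have h := (Real.continuousAt_rpow_const 0 p (Or.inr hp.le)).tendsto
  rw [Real.zero_rpow hp.ne'] at h
  exact h.mono_left nhdsWithin_le_nhds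

lemma prod_rpow_rpow {n : ℕ} {t : ℝ} (ht : 0 < t) (w x : Fin n → ℝ) :
    ∏ i, (t ^ w i) ^ x i = t ^ ∑ i, w i * x i := by
  rw [Real.rpow_sum_of_pos ht]
  exact Finset.prod_congr rfl fun i _ => (Real.rpow_mul ht.le _ _).symm

/-- if `b ≥ 0` and `b ∉ Γ⁺(A)` then no estimate
`∏|zᵢ|^{bᵢ} ≤ C Σ_{a∈A} ∏|zᵢ|^{aᵢ}` can hold near `0`: for all `C, ε > 0` there is `z`
with `0 < |zᵢ| < ε` violating it. -/
theorem stmt4 (n : ℕ) (hn : 1 ≤ n) (A : Finset (Fin n →₀ ℕ)) (hA : A.Nonempty)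
    (b : Fin n → ℝ) (hbnn : ∀ i, 0 ≤ b i) (hb : b ∉ newtonPolyhedron n A) :
    ∀ C > (0 : ℝ), ∀ ε > (0 : ℝ), ∃ z : Fin n → ℂ,
      (∀ i, 0 < ‖z i‖ ∧ ‖z i‖ < ε) ∧
      C * ∑ a ∈ A, ∏ i, ‖z i‖ ^ ((a i : ℝ)) < ∏ i, ‖z i‖ ^ (b i) := by
  intro C _ ε hε
  obtain ⟨w, hw, hwA⟩ := exists_pos_weight_of_notMem_newtonPolyhedron hA hbnn hb
  have hsmall : ∀ᶠ t : ℝ in nhdsWithin 0 (Set.Ioi 0), ∀ i, t ^ w i < ε :=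
    Filter.eventually_all.2 fun i => (tendsto_rpow_nhdsGT_zero (hw i)).eventually_lt_const hε
  have hlim : Filter.Tendsto
      (fun t : ℝ => C * ∑ a ∈ A, t ^ (∑ i, w i * (a i : ℝ) - ∑ i, w i * b i))
      (nhdsWithin 0 (Set.Ioi 0)) (nhds 0) := by
    simpa using (tendsto_finsetSum A fun a ha =>
      tendsto_rpow_nhdsGT_zero (sub_pos.2 (hwA a ha))).const_mul C
  obtain ⟨t, ⟨htε, htC⟩, ht⟩ :=
    ((hsmall.and (hlim.eventually_lt_const one_pos)).and self_mem_nhdsWithin).exists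
  replace ht : 0 < t := ht
  have hnorm (i : Fin n) : ‖((t ^ w i : ℝ) : ℂ)‖ = t ^ w i :=
    Complex.norm_of_nonneg (Real.rpow_nonneg ht.le _)
  refine ⟨fun i => ((t ^ w i : ℝ) : ℂ), fun i => ?_, ?_⟩
  · rw [hnorm]
    exact ⟨Real.rpow_pos_of_pos ht _, htε i⟩
  · simp only [hnorm, prod_rpow_rpow ht]
    have hpos := Real.rpow_pos_of_pos ht (∑ i, w i * b i)
    simp only [Real.rpow_sub ht, ← Finset.sum_div, ← mul_div_assoc] at htC
    exact (div_lt_one hpos).1 htC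
end

section
/- Let n ≥ 1, let A ⊆ ℕⁿ be finite and nonempty, let I = (X^A) be the monomial ideal of ℂ[X₁,…,Xₙ] generated by {X^a : a ∈ A}, and let b ∈ ℕⁿ. Then the following are equivalent: (i) X^b is integral over I, i.e. there exist r ≥ 1 and polynomials g₁,…,g_r with gᵢ ∈ Iⁱ for each i and (X^b)^r + g₁·(X^b)^{r−1} + ⋯ + g_{r−1}·X^b + g_r = 0; (ii) b, viewed as a point of ℝⁿ, lies in the Newton polyhedron Γ⁺(A). (Integral closure of a monomial ideal is generated by the monomials with exponents in the Newton polyhedron.) -/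
open Pointwise MvPolynomial

/-- Every exponent of a polynomial in the `k`-th power of the monomial ideal `(X^A)` dominates
a sum of `k` elements of `A`. -/
theorem exists_sum_le_of_mem_support_of_mem_span_pow {σ R : Type*} [CommRing R]
    {A : Set (σ →₀ ℕ)} {k : ℕ} {p : MvPolynomial σ R}
    (hp : p ∈ (Ideal.span ((fun a => monomial a (1 : R)) '' A)) ^ k) {c : σ →₀ ℕ}
    (hc : c ∈ p.support) :
    ∃ f : Fin k → σ →₀ ℕ, (∀ j, f j ∈ A) ∧ ∑ j, f j ≤ c := by
  have hle : (Ideal.span ((fun a => monomial a (1 : R)) '' A)) ^ k ≤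
      Ideal.span ((fun a => monomial a (1 : R)) ''
        {d | ∃ f : Fin k → σ →₀ ℕ, (∀ j, f j ∈ A) ∧ ∑ j, f j = d}) := by
    rw [Ideal.span, Ideal.span, Submodule.span_pow]
    apply Submodule.span_mono
    intro x hx
    obtain ⟨g, rfl⟩ := Set.mem_pow.1 hx
    choose f hfA hf using fun j => (g j).2
    refine ⟨∑ j, f j, ⟨f, hfA, rfl⟩, ?_⟩
    simp only [List.prod_ofFn, ← hf, monomial_sum_one]
  obtain ⟨_, ⟨f, hfA, rfl⟩, hfc⟩ := mem_ideal_span_monomial_image.1 (hle hp) c hc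
  exact ⟨f, hfA, hfc⟩

/-- If the monomial exponent `c` dominates a combination of elements of `A` with natural weights
of total at least `k`, then `X^c` lies in the `k`-th power of `(X^A)`. -/
theorem monomial_mem_span_pow {σ R : Type*} [CommRing R]
    {A : Finset (σ →₀ ℕ)} {k : ℕ} {c : σ →₀ ℕ} (m : (σ →₀ ℕ) → ℕ)
    (hk : k ≤ ∑ a ∈ A, m a) (hc : ∑ a ∈ A, m a • a ≤ c) :
    monomial c (1 : R) ∈
      (Ideal.span ((fun a => monomial a (1 : R)) '' (A : Set (σ →₀ ℕ)))) ^ k := by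
  apply Ideal.pow_le_pow_right hk
  have hmem : monomial (∑ a ∈ A, m a • a) (1 : R) ∈
      (Ideal.span ((fun a => monomial a (1 : R)) '' (A : Set (σ →₀ ℕ)))) ^ ∑ a ∈ A, m a := by
    rw [monomial_sum_one, ← Finset.prod_pow_eq_pow_sum]
    refine Ideal.prod_mem_prod fun a ha => ?_
    have := Ideal.pow_mem_pow
      (Ideal.subset_span (Set.mem_image_of_mem (fun a => monomial a (1 : R)) ha)) (m a)
    simpa [monomial_pow] using this
  have := Ideal.mul_mem_left _ (monomial (c - ∑ a ∈ A, m a • a) (1 : R)) hmem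
  rwa [monomial_mul, one_mul, tsub_add_cancel_of_le hc] at this

/-- If `b` dominates `k⁻¹` times a sum of `k` elements of `A`, then it lies in the Newton
polyhedron of `A`. -/
theorem mem_newtonPolyhedron_of_sum_le {n : ℕ} {A : Finset (Fin n →₀ ℕ)} {b : Fin n →₀ ℕ}
    {k : ℕ} (hk : 1 ≤ k) {f : Fin k → Fin n →₀ ℕ} (hfA : ∀ j, f j ∈ A)
    (hf : ∑ j, f j ≤ k • b) :
    (fun i : Fin n => (b i : ℝ)) ∈ newtonPolyhedron n A := by
  have hk0 : (0 : ℝ) < k := by exact_mod_cast hk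
  refine Set.mem_add.2 ⟨∑ j, (k : ℝ)⁻¹ • fun i => (f j i : ℝ), ?_,
    (fun i => (b i : ℝ)) - ∑ j, (k : ℝ)⁻¹ • fun i => (f j i : ℝ), ?_, by abel⟩
  · refine (convex_convexHull ℝ _).sum_mem (fun _ _ => by positivity) ?_
      fun j _ => subset_convexHull ℝ _ ⟨f j, hfA j, rfl⟩
    simp [hk0.ne']
  · intro i
    have h : ((∑ j, f j i : ℕ) : ℝ) ≤ k * b i := by
      have := hf i
      simp only [Finsupp.coe_finsetSum, Finset.sum_apply, Finsupp.smul_apply,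
        smul_eq_mul] at this
      exact_mod_cast this
    push_cast at h
    simp only [Pi.sub_apply, Finset.sum_apply, Pi.smul_apply, smul_eq_mul, ← Finset.mul_sum,
      sub_nonneg]
    rwa [inv_mul_le_iff₀ hk0]

/-- A lattice point dominating a real convex combination of `A` has a positive multiple `k • b`
dominating a combination of `A` with natural weights of total at least `k`. -/
theorem exists_nat_weights {σ : Type*} [Finite σ] {A : Finset (σ →₀ ℕ)} {b : σ →₀ ℕ}
    {w : (σ →₀ ℕ) → ℝ} (hw : ∀ a ∈ A, 0 ≤ w a) (hw1 : ∑ a ∈ A, w a = 1)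
    (hwb : ∀ i, ∑ a ∈ A, w a * a i ≤ b i) :
    ∃ k : ℕ, 1 ≤ k ∧ ∃ m : (σ →₀ ℕ) → ℕ, k ≤ ∑ a ∈ A, m a ∧ ∑ a ∈ A, m a • a ≤ k • b := by
  let fl (k : ℕ) (a : σ →₀ ℕ) : ℕ := ⌊k * w a⌋₊
  have hfl (k : ℕ) {a} (ha : a ∈ A) : (fl k a : ℝ) ≤ k * w a :=
    Nat.floor_le (mul_nonneg k.cast_nonneg (hw a ha))
  have hsum (k : ℕ) (i : σ) : ∑ a ∈ A, fl k a * a i ≤ k * b i := by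
    have : ∑ a ∈ A, (fl k a : ℝ) * a i ≤ k * b i := calc
      _ ≤ ∑ a ∈ A, k * w a * a i := by
        gcongr with a ha
        exact hfl k ha
      _ = k * ∑ a ∈ A, w a * a i := by simp only [Finset.mul_sum, mul_assoc]
      _ ≤ _ := by gcongr; exact hwb i
    exact_mod_cast this
  have hcard (k : ℕ) : k ≤ ∑ a ∈ A, fl k a + A.card := by
    have : (k : ℝ) ≤ ∑ a ∈ A, (fl k a : ℝ) + A.card := calc
      (k : ℝ) = ∑ a ∈ A, k * w a := by rw [← Finset.mul_sum, hw1, mul_one]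
      _ ≤ ∑ a ∈ A, ((fl k a : ℝ) + 1) := by
        gcongr with a ha
        exact (Nat.lt_floor_add_one _).le
      _ = _ := by simp [Finset.sum_add_distrib]
    exact_mod_cast this
  have hmono {k l : ℕ} (hkl : k ≤ l) {a} (ha : a ∈ A) : fl k a ≤ fl l a := by
    have := hw a ha
    apply Nat.floor_le_floor
    gcongr
  -- Dickson's lemma for the defects of the rounded-down weights `⌊k w⌋`.
  obtain ⟨k, l, hkl, hv, hc⟩ := wellQuasiOrdered_le
    (fun k : ℕ => ((fun i => k * b i - ∑ a ∈ A, fl k a * a i,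
      ∑ a ∈ A, fl k a + A.card - k) : (σ → ℕ) × ℕ))
  refine ⟨l - k, by omega, fun a => fl l a - fl k a, ?_, fun i => ?_⟩
  · rw [Finset.sum_tsub_distrib _ fun a ha => hmono hkl.le ha]
    have := hcard k
    have := hcard l
    dsimp only at hc
    omega
  · have hvi := hv i
    have := hsum k i
    have := hsum l i
    dsimp only at hvi
    simp only [Finsupp.coe_finsetSum, Finset.sum_apply, Finsupp.smul_apply, smul_eq_mul,
      tsub_mul]
    rw [Finset.sum_tsub_distrib _ fun a ha => Nat.mul_le_mul_right _ (hmono hkl.le ha)]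
    omega

/-- `X^b` is integral over the monomial ideal `I = (X^A)` (it satisfies a
monic equation `(X^b)^r + g₁(X^b)^{r−1} + ⋯ + g_r = 0` with `gᵢ ∈ Iⁱ`) iff `b` lies in
the Newton polyhedron `Γ⁺(A)`. -/
theorem stmt5 (n : ℕ) (hn : 1 ≤ n) (A : Finset (Fin n →₀ ℕ)) (hA : A.Nonempty)
    (b : Fin n →₀ ℕ) :
    (∃ r : ℕ, 1 ≤ r ∧ ∃ g : ℕ → MvPolynomial (Fin n) ℂ,
        (∀ i ∈ Finset.Icc 1 r,
          g i ∈ (Ideal.span ((fun a : Fin n →₀ ℕ => (monomial a (1 : ℂ))) ''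
            (A : Set (Fin n →₀ ℕ)))) ^ i) ∧
        (monomial b (1 : ℂ)) ^ r +
          ∑ i ∈ Finset.Icc 1 r, g i * (monomial b (1 : ℂ)) ^ (r - i) = 0) ↔
      (fun i : Fin n => (b i : ℝ)) ∈ newtonPolyhedron n A := by
  constructor
  · rintro ⟨r, -, g, hg, heq⟩
    have hcoeff := congrArg (coeff (r • b)) heq
    simp only [monomial_pow, one_pow, coeff_add, coeff_monomial, if_true, coeff_sum,
      coeff_zero] at hcoeff
    obtain ⟨i, hi, hne⟩ := Finset.exists_ne_zero_of_sum_ne_zero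
      (fun h => one_ne_zero (by rwa [h, add_zero] at hcoeff))
    obtain ⟨hi1, hir⟩ := Finset.mem_Icc.1 hi
    rw [← Nat.add_sub_of_le hir, add_smul, Nat.add_sub_of_le hir, coeff_mul_monomial,
      mul_one] at hne
    obtain ⟨f, hfA, hf⟩ :=
      exists_sum_le_of_mem_support_of_mem_span_pow (hg i hi) (mem_support_iff.2 hne)
    exact mem_newtonPolyhedron_of_sum_le hi1 hfA hf
  · intro hb
    obtain ⟨_, hx, s, hs, hxs⟩ := Set.mem_add.1 hb
    rw [← Finset.coe_image, Finset.mem_convexHull'] at hx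
    obtain ⟨w, hw, hw1, rfl⟩ := hx
    have hinj : Set.InjOn (fun (a : Fin n →₀ ℕ) (i : Fin n) => (a i : ℝ)) A :=
      fun a _ a' _ h => Finsupp.ext fun i => Nat.cast_injective (congrFun h i)
    rw [Finset.sum_image hinj] at hw1 hxs
    obtain ⟨k, hk, m, hkm, hm⟩ := exists_nat_weights (b := b)
      (fun a ha => hw _ (Finset.mem_image_of_mem _ ha)) hw1 fun i => by
        have := congrFun hxs i
        simp only [Pi.add_apply, Finset.sum_apply, Pi.smul_apply, smul_eq_mul] at this
        linarith [hs i]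
    refine ⟨k, hk, fun i => if i = k then -monomial (k • b) 1 else 0, fun i _ => ?_, ?_⟩
    · dsimp only
      split_ifs with h
      · subst h
        exact neg_mem (monomial_mem_span_pow m hkm hm)
      · exact zero_mem _
    · simp [hk, monomial_pow, ite_mul]
end

section
/- Let n ≥ 1 and let a₁,…,aₙ ∈ ℕⁿ be such that the n×n matrix M with columns a₁,…,aₙ has nonzero determinant (over ℚ or ℝ). Suppose that for every i ∈ {1,…,n} there exists k ∈ {1,…,n} such that (aᵢ)ₖ ≥ Σ_{j=1}^n (aⱼ)ₖ (equivalently, the monomial X^{aᵢ} is divisible by X_k^{α_k}, where α = a₁ + ⋯ + aₙ). Then there exists a permutation σ of {1,…,n} such that for every i, aᵢ is a positive multiple of the standard basis vector e_{σ(i)}, i.e. (aᵢ)ₘ = 0 for all m ≠ σ(i) and (aᵢ)_{σ(i)} > 0. In particular each aᵢ lies on a coordinate axis and every coordinate axis is met. -/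
/-- if `a₁,…,aₙ ∈ ℕⁿ` are the columns of a matrix with nonzero determinant
and each `aᵢ` dominates, in some coordinate `k`, the `k`-th coordinate of `α = Σⱼ aⱼ`,
then some permutation `σ` makes each `aᵢ` a positive multiple of the basis vector
`e_{σ(i)}`. -/
theorem stmt8 (n : ℕ) (hn : 1 ≤ n) (a : Fin n → (Fin n → ℕ))
    (hdet : (Matrix.of fun k i : Fin n => ((a i k : ℝ))).det ≠ 0)
    (hdom : ∀ i : Fin n, ∃ k : Fin n, (∑ j, a j k) ≤ a i k) :
    ∃ σ : Equiv.Perm (Fin n), ∀ i : Fin n,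
      (∀ m : Fin n, m ≠ σ i → a i m = 0) ∧ 0 < a i (σ i) := by
  choose f hf using hdom
  have eq_zero_of_ne : ∀ i j, j ≠ i → a j (f i) = 0 := by
    intro i j hji
    have h := Finset.add_le_sum (f := fun l => a l (f i)) (fun _ _ => Nat.zero_le _)
      (Finset.mem_univ j) (Finset.mem_univ i) hji
    have := hf i
    omega
  have pos : ∀ i, 0 < a i (f i) := by
    intro i
    by_contra! h
    refine hdet (Matrix.det_eq_zero_of_row_eq_zero (f i) fun j => ?_)
    rcases eq_or_ne j i with rfl | hji
    · simpa using h
    · simpa using eq_zero_of_ne i j hji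
  have inj : Function.Injective f := by
    intro i j hij
    by_contra hne
    have h := eq_zero_of_ne j i hne
    rw [← hij] at h
    exact (pos i).ne' h
  refine ⟨Equiv.ofBijective f (Finite.injective_iff_bijective.mp inj),
    fun i => ⟨fun m hm => ?_, pos i⟩⟩
  obtain ⟨j, rfl⟩ := Finite.surjective_of_injective inj m
  exact eq_zero_of_ne j i fun hij => hm (by simp [hij])
end

section
/- Let n ≥ 1 and let A ⊆ ℕⁿ be a finite set with variety {0}. Then A possesses at least one essential subset B. -/
/-- `B` is an essential subset of `A`: `B ⊆ A` has `n` linearly independent elements and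
lies in a facet of the Newton polyhedron `Γ⁺(A)`. -/
def essential (n : ℕ) (A B : Finset (Fin n →₀ ℕ)) : Prop :=
  B ⊆ A ∧ B.card = n ∧
    LinearIndependent ℝ (fun b : B => fun i : Fin n => ((b : Fin n →₀ ℕ) i : ℝ)) ∧
    ∃ ρ : Fin n → ℝ, (∀ i, 0 ≤ ρ i) ∧ ρ ≠ 0 ∧ ∃ c : ℝ,
      (∀ b ∈ B, ∑ i, ρ i * (b i : ℝ) = c) ∧ ∀ a ∈ A, c ≤ ∑ i, ρ i * (a i : ℝ)

/-- If a linear functional is at least `1` on a finite spanning family, then for each `k` at most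
the dimension some such functional equals `1` on `k` linearly independent members of the family. -/
theorem exists_linearIndepOn_tight {ι V : Type*} [AddCommGroup V] [Module ℝ V]
    [FiniteDimensional ℝ V] (A : Finset ι) (f : ι → V)
    (hspan : Submodule.span ℝ (f '' A) = ⊤) (φ₀ : Module.Dual ℝ V)
    (hφ₀ : ∀ a ∈ A, 1 ≤ φ₀ (f a)) (k : ℕ) (hk : k ≤ Module.finrank ℝ V) :
    ∃ B ⊆ A, B.card = k ∧ LinearIndepOn ℝ f (B : Set ι) ∧
      ∃ φ : Module.Dual ℝ V, (∀ b ∈ B, φ (f b) = 1) ∧ ∀ a ∈ A, 1 ≤ φ (f a) := by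
  classical
  induction k with
  | zero => exact ⟨∅, by simp, rfl, by simp, φ₀, by simp, hφ₀⟩
  | succ k ih =>
    obtain ⟨B, hBA, hBk, hB, φ, hφB, hφA⟩ := ih (by omega)
    have hlt : Submodule.span ℝ (f '' B) < ⊤ := by
      refine Submodule.lt_top_of_finrank_lt_finrank ?_
      have h := finrank_span_finset_le_card (R := ℝ) (B.image f)
      rw [Finset.coe_image] at h
      have := Finset.card_image_le (s := B) (f := f)
      unfold Set.finrank at h
      omega
    obtain ⟨ψ, hψB, hneg⟩ : ∃ ψ : Module.Dual ℝ V,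
        Submodule.span ℝ (f '' B) ≤ LinearMap.ker ψ ∧ ∃ a ∈ A, ψ (f a) < 0 := by
      obtain ⟨ψ, hψ0, hψB⟩ := Submodule.exists_le_ker_of_lt_top _ hlt
      obtain ⟨a, ha, hne⟩ : ∃ a ∈ A, ψ (f a) ≠ 0 := by
        by_contra! h
        refine hψ0 (LinearMap.ext_on hspan ?_)
        rintro _ ⟨a, ha, rfl⟩
        simpa using h a ha
      rcases lt_or_gt_of_ne hne with h | h
      · exact ⟨ψ, hψB, a, ha, h⟩
      · exact ⟨-ψ, fun x hx => by simpa using hψB hx, a, ha, by simpa using h⟩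
    obtain ⟨a, ha, hmin⟩ := Finset.exists_min_image (A.filter fun a => ψ (f a) < 0)
      (fun a => (φ (f a) - 1) / -ψ (f a)) (by simpa [Finset.Nonempty] using hneg)
    obtain ⟨haA, haneg⟩ := Finset.mem_filter.mp ha
    have ha_notMem : f a ∉ Submodule.span ℝ (f '' B) := fun h =>
      haneg.ne (LinearMap.mem_ker.mp (hψB h))
    have ha_notMem_B : a ∉ B := fun h => ha_notMem (Submodule.subset_span ⟨a, h, rfl⟩)
    set t := (φ (f a) - 1) / -ψ (f a) with ht
    have ht0 : 0 ≤ t := div_nonneg (by linarith [hφA a haA]) (by linarith)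
    refine ⟨insert a B, Finset.insert_subset haA hBA, by
      rw [Finset.card_insert_of_notMem ha_notMem_B, hBk], ?_, φ + t • ψ, ?_, ?_⟩
    · rw [Finset.coe_insert]
      exact hB.insert ha_notMem
    · intro b hb
      rcases Finset.mem_insert.mp hb with rfl | hb
      · have : ψ (f b) ≠ 0 := haneg.ne
        simp only [LinearMap.add_apply, LinearMap.smul_apply, smul_eq_mul, ht]
        field_simp
        ring
      · have : ψ (f b) = 0 := LinearMap.mem_ker.mp (hψB (Submodule.subset_span ⟨b, hb, rfl⟩))
        simp [this, hφB b hb]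
    · intro x hx
      simp only [LinearMap.add_apply, LinearMap.smul_apply, smul_eq_mul]
      rcases lt_or_ge (ψ (f x)) 0 with h | h
      · have := hmin x (Finset.mem_filter.mpr ⟨hx, h⟩)
        rw [le_div_iff₀ (by linarith)] at this
        linarith
      · linarith [hφA x hx, mul_nonneg ht0 h]

/-- a finite `A ⊆ ℕⁿ` with variety `{0}` has at least one essential subset. -/
theorem stmt9 (n : ℕ) (hn : 1 ≤ n) (A : Finset (Fin n →₀ ℕ))
    (hA : hasVarietyZero n A) :
    ∃ B : Finset (Fin n →₀ ℕ), essential n A B := by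
  obtain ⟨h0, hA⟩ := hA
  set f : (Fin n →₀ ℕ) → (Fin n → ℝ) := fun a i => (a i : ℝ) with hf
  have hsingle (i : Fin n) (k : ℕ) : f (Finsupp.single i k) = (k : ℝ) • Pi.single i (1 : ℝ) := by
    ext j
    by_cases h : j = i
    · subst h; simp [hf]
    · simp [hf, h]
  have hspan : Submodule.span ℝ (f '' A) = ⊤ := by
    rw [eq_top_iff, ← (Pi.basisFun ℝ (Fin n)).span_eq, Submodule.span_le]
    rintro _ ⟨i, rfl⟩
    obtain ⟨k, hk, hkA⟩ := hA i
    have hk0 : (k : ℝ) ≠ 0 := by positivity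
    have h : f (Finsupp.single i k) ∈ Submodule.span ℝ (f '' A) :=
      Submodule.subset_span ⟨_, hkA, rfl⟩
    rw [hsingle, Submodule.smul_mem_iff _ hk0] at h
    simpa using h
  have hone : ∀ a ∈ A, 1 ≤ (∑ i, LinearMap.proj i : Module.Dual ℝ (Fin n → ℝ)) (f a) := by
    intro a ha
    obtain ⟨i, hi⟩ := Finsupp.ne_iff.mp (ne_of_mem_of_not_mem ha h0)
    have h1 : 1 ≤ ∑ j, a j := (Nat.one_le_iff_ne_zero.mpr hi).trans
      (Finset.single_le_sum (fun _ _ => Nat.zero_le _) (Finset.mem_univ i))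
    simp only [LinearMap.sum_apply, LinearMap.proj_apply, hf]
    exact_mod_cast h1
  obtain ⟨B, hBA, hBn, hB, φ, hφB, hφA⟩ :=
    exists_linearIndepOn_tight A f hspan _ hone n (by simp)
  have hφ (a : Fin n →₀ ℕ) : ∑ i, φ (Pi.single i 1) * (a i : ℝ) = φ (f a) := by
    rw [LinearMap.pi_apply_eq_sum_univ φ (f a)]
    refine Finset.sum_congr rfl fun i _ => ?_
    have h : (fun j => if i = j then (1 : ℝ) else 0) = Pi.single i 1 := by
      ext j
      simp [Pi.single_apply, eq_comm]
    rw [h, smul_eq_mul, mul_comm]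
  have hpos (i : Fin n) : 0 < φ (Pi.single i 1) := by
    obtain ⟨k, -, hkA⟩ := hA i
    have h := hφA _ hkA
    rw [hsingle, map_smul, smul_eq_mul] at h
    exact pos_of_mul_pos_right (one_pos.trans_le h) k.cast_nonneg
  refine ⟨B, hBA, hBn, hB, fun i => φ (Pi.single i 1), fun i => (hpos i).le,
    fun h => (hpos ⟨0, hn⟩).ne' (congrFun h _), 1, fun b hb => ?_, fun a ha => ?_⟩
  · rw [hφ, hφB b hb]
  · rw [hφ]
    exact hφA a ha
end

section
/- Let n ≥ 2 and let A ⊆ ℕⁿ be a finite set with variety {0}. In ℂ[X₁,…,Xₙ], let K be the ideal generated by all monomials X^b with b ∈ ℕⁿ such that b (viewed in ℝⁿ) lies in the dilated Newton polyhedron n • Γ⁺(A), and let J = ⋂_{B essential subset of A} (X₁^{α₁^B}, …, Xₙ^{αₙ^B}), where α^B = Σ_{a∈B} a. Then K is strictly contained in J: K ⊆ J and K ≠ J. (This is the combinatorial form, obtained via the main theorem, of the statement that the integral closure of (z^A)ⁿ is strictly included in the annihilator of the Bochner–Martinelli residue current of z^A.) -/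
open Pointwise MvPolynomial

/-- A linear form with nonnegative coefficients that is at least `c` on `A` is at least `c` on the
Newton polyhedron of `A`. -/
theorem le_sum_mul_of_mem_newtonPolyhedron {n : ℕ} {A : Finset (Fin n →₀ ℕ)} {ρ : Fin n → ℝ}
    (hρ : ∀ i, 0 ≤ ρ i) {c : ℝ} (hc : ∀ a ∈ A, c ≤ ∑ i, ρ i * (a i : ℝ)) {x : Fin n → ℝ}
    (hx : x ∈ newtonPolyhedron n A) : c ≤ ∑ i, ρ i * x i := by
  obtain ⟨p, hp, r, hr, rfl⟩ := hx
  have hlin : IsLinearMap ℝ fun y : Fin n → ℝ => ∑ i, ρ i * y i :=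
    ⟨fun y z => by simp [mul_add, Finset.sum_add_distrib],
      fun t y => by simp [Finset.mul_sum, mul_left_comm]⟩
  have hp' : p ∈ {y : Fin n → ℝ | c ≤ ∑ i, ρ i * y i} := by
    refine convexHull_min ?_ (convex_halfSpace_ge hlin c) hp
    rintro _ ⟨a, ha, rfl⟩
    exact hc a ha
  have hr' : 0 ≤ ∑ i, ρ i * r i := Finset.sum_nonneg fun i _ => mul_nonneg (hρ i) (hr i)
  simp only [Pi.add_apply, mul_add, Finset.sum_add_distrib]
  linarith [show c ≤ ∑ i, ρ i * p i from hp']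

/-- The dilated form of `le_sum_mul_of_mem_newtonPolyhedron`. -/
theorem mul_le_sum_mul_of_mem_smul_newtonPolyhedron {n : ℕ} {A : Finset (Fin n →₀ ℕ)}
    {ρ : Fin n → ℝ} (hρ : ∀ i, 0 ≤ ρ i) {c : ℝ} (hc : ∀ a ∈ A, c ≤ ∑ i, ρ i * (a i : ℝ))
    {y : Fin n → ℝ} (hy : y ∈ (fun x : Fin n → ℝ => (n : ℝ) • x) '' newtonPolyhedron n A) :
    n * c ≤ ∑ i, ρ i * y i := by
  obtain ⟨x, hx, rfl⟩ := hy
  have h := mul_le_mul_of_nonneg_left (le_sum_mul_of_mem_newtonPolyhedron hρ hc hx)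
    (Nat.cast_nonneg (α := ℝ) n)
  rw [Finset.mul_sum] at h
  simpa [mul_left_comm] using h

theorem monomial_mem_span_range_X_pow {σ R : Type*} [CommSemiring R] {b α : σ →₀ ℕ} {i : σ}
    (h : α i ≤ b i) :
    monomial b (1 : R) ∈ Ideal.span (Set.range fun i : σ => (X i : MvPolynomial σ R) ^ α i) := by
  refine Ideal.mem_of_dvd _ ?_ (Ideal.subset_span (Set.mem_range_self i))
  rw [X_pow_eq_monomial, monomial_dvd_monomial]
  exact ⟨Or.inr (Finsupp.single_le_iff.mpr h), one_dvd _⟩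

/-- If `b ∈ n • Γ⁺(A)`, then `b` is not strictly below the exponent sum of an essential set. -/
theorem essential.exists_sum_le {n : ℕ} {A B : Finset (Fin n →₀ ℕ)} (hB : essential n A B)
    {b : Fin n →₀ ℕ} (hb : (fun i : Fin n => (b i : ℝ)) ∈
      (fun x : Fin n → ℝ => (n : ℝ) • x) '' newtonPolyhedron n A) :
    ∃ i, (∑ a ∈ B, a) i ≤ b i := by
  obtain ⟨-, hcard, -, ρ, hρ, hρ0, c, hBc, hAc⟩ := hB
  by_contra! h
  have hle := mul_le_sum_mul_of_mem_smul_newtonPolyhedron hρ hAc hb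
  have hsum : ∑ i, ρ i * ((∑ a ∈ B, a) i : ℝ) = n * c := by
    simp_rw [Finsupp.finsetSum_apply, Nat.cast_sum, Finset.mul_sum]
    rw [Finset.sum_comm, Finset.sum_congr rfl hBc, Finset.sum_const, hcard, nsmul_eq_mul]
  obtain ⟨j, hj⟩ := Function.ne_iff.mp hρ0
  have hlt : ∑ i, ρ i * (b i : ℝ) < ∑ i, ρ i * ((∑ a ∈ B, a) i : ℝ) := by
    refine Finset.sum_lt_sum (fun i _ => ?_) ⟨j, Finset.mem_univ j, ?_⟩
    · exact mul_le_mul_of_nonneg_left (by exact_mod_cast (h i).le) (hρ i)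
    · exact mul_lt_mul_of_pos_left (by exact_mod_cast h j) ((hρ j).lt_of_ne' hj)
  linarith

/-- A nonzero linear form cannot vanish on `n` linearly independent vectors. -/
theorem eq_zero_of_linearIndependent_of_sum_mul_eq_zero {n : ℕ} {B : Finset (Fin n →₀ ℕ)}
    (hcard : B.card = n)
    (hli : LinearIndependent ℝ (fun b : B => fun i : Fin n => ((b : Fin n →₀ ℕ) i : ℝ)))
    {ρ : Fin n → ℝ} (hρ : ∀ b ∈ B, ∑ i, ρ i * (b i : ℝ) = 0) : ρ = 0 := by
  have hspan := hli.span_eq_top_of_card_eq_finrank' (by simp [hcard])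
  have hf : (∑ i, ρ i • LinearMap.proj (R := ℝ) (φ := fun _ : Fin n => ℝ) i) = 0 := by
    refine LinearMap.ext_on_range hspan fun b => ?_
    simpa using hρ b b.2
  funext j
  simpa [Pi.single_apply] using LinearMap.congr_fun hf (Pi.single j 1)

/-- A point of an essential set has `j`-th coordinate at most `k` whenever `k • eⱼ ∈ A`, with
equality only for `k • eⱼ` itself. -/
theorem essential.apply_lt {n : ℕ} {A B : Finset (Fin n →₀ ℕ)} (hA : hasVarietyZero n A)
    (hB : essential n A B) {j : Fin n} {k : ℕ} (hk : Finsupp.single j k ∈ A)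
    {b : Fin n →₀ ℕ} (hb : b ∈ B) (hne : b ≠ Finsupp.single j k) : b j < k := by
  obtain ⟨-, hcard, hli, ρ, hρ, hρ0, c, hBc, hAc⟩ := hB
  have hc : 0 < c := by
    refine lt_of_le_of_ne' ?_ fun hc => hρ0 ?_
    · rw [← hBc b hb]
      exact Finset.sum_nonneg fun i _ => mul_nonneg (hρ i) (Nat.cast_nonneg _)
    · exact eq_zero_of_linearIndependent_of_sum_mul_eq_zero hcard hli (hc ▸ hBc)
  have haxis : ∀ i m, Finsupp.single i m ∈ A → c ≤ ρ i * m := fun i m hm => by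
    simpa [Finsupp.single_apply] using hAc _ hm
  have hpos : ∀ i, 0 < ρ i := fun i => by
    obtain ⟨m, -, hm⟩ := hA.2 i
    exact pos_of_mul_pos_left (hc.trans_le (haxis i m hm)) (Nat.cast_nonneg m)
  by_contra! hkb
  have hb_le : ∑ i, ρ i * (b i : ℝ) ≤ ∑ i, ρ i * (Finsupp.single j k i : ℝ) := by
    rw [hBc b hb]
    exact hAc _ hk
  have hle : Finsupp.single j k ≤ b := Finsupp.single_le_iff.mpr hkb
  obtain ⟨i, hi⟩ := Finsupp.ne_iff.mp hne
  refine hb_le.not_gt (Finset.sum_lt_sum (fun i _ => ?_) ⟨i, Finset.mem_univ i, ?_⟩)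
  · exact mul_le_mul_of_nonneg_left (by exact_mod_cast hle i) (hρ i)
  · exact mul_lt_mul_of_pos_left (by exact_mod_cast (hle i).lt_of_ne' hi) (hpos i)

theorem essential.sum_apply_lt {n : ℕ} (hn : 2 ≤ n) {A B : Finset (Fin n →₀ ℕ)}
    (hA : hasVarietyZero n A) (hB : essential n A B) {j : Fin n} {k : ℕ}
    (hk : Finsupp.single j k ∈ A) : (∑ a ∈ B, a) j < n * k := by
  obtain ⟨b, hb, hne⟩ := Finset.exists_mem_ne (by rw [hB.2.1]; omega) (Finsupp.single j k)
  have hsum : ∑ _a ∈ B, k = n * k := by rw [Finset.sum_const, hB.2.1, smul_eq_mul]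
  rw [Finsupp.finsetSum_apply, ← hsum]
  refine Finset.sum_lt_sum (fun a ha => ?_) ⟨b, hb, hB.apply_lt hA hk hb hne⟩
  obtain rfl | hne := eq_or_ne a (Finsupp.single j k)
  · simp
  · exact (hB.apply_lt hA hk ha hne).le

/-- If `k • eⱼ` is the lowest point of `A` on the `j`-th axis, every multiple of `eⱼ` dominating a
point of `n • Γ⁺(A)` is at least `n * k • eⱼ`. -/
theorem mul_le_of_le_single {n : ℕ} {A : Finset (Fin n →₀ ℕ)} (hA : (0 : Fin n →₀ ℕ) ∉ A)
    {j : Fin n} {k : ℕ} (hmin : ∀ m, 1 ≤ m → Finsupp.single j m ∈ A → k ≤ m) {b : Fin n →₀ ℕ}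
    (hb : (fun i : Fin n => (b i : ℝ)) ∈
      (fun x : Fin n → ℝ => (n : ℝ) • x) '' newtonPolyhedron n A)
    {m : ℕ} (hbm : b ≤ Finsupp.single j m) : n * k ≤ m := by
  have hρ : ∀ i, 0 ≤ (if i = j then 1 else k : ℝ) := fun i => by split_ifs <;> positivity
  have hle := mul_le_sum_mul_of_mem_smul_newtonPolyhedron (c := (k : ℝ)) hρ (fun a ha => ?_) hb
  · have hlt : ∑ i, (if i = j then 1 else k : ℝ) * (b i : ℝ) ≤
        ∑ i, (if i = j then 1 else k : ℝ) * (Finsupp.single j m i : ℝ) :=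
      Finset.sum_le_sum fun i _ =>
        mul_le_mul_of_nonneg_left (by exact_mod_cast hbm i) (hρ i)
    have hm : ∑ i, (if i = j then 1 else k : ℝ) * (Finsupp.single j m i : ℝ) = m := by
      simp [Finsupp.single_apply]
    exact_mod_cast (hle.trans hlt).trans_eq hm
  · have hterm : ∀ i, (if i = j then 1 else k : ℝ) * (a i : ℝ) ≤
        ∑ i, (if i = j then 1 else k : ℝ) * (a i : ℝ) := fun i =>
      Finset.single_le_sum (f := fun i => (if i = j then 1 else k : ℝ) * (a i : ℝ))
        (fun i _ => mul_nonneg (hρ i) (Nat.cast_nonneg _)) (Finset.mem_univ i)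
    by_cases h : ∃ i, i ≠ j ∧ a i ≠ 0
    · obtain ⟨i, hij, hi⟩ := h
      refine le_trans ?_ (hterm i)
      rw [if_neg hij]
      exact le_mul_of_one_le_right (Nat.cast_nonneg k)
        (by exact_mod_cast Nat.one_le_iff_ne_zero.mpr hi)
    · push Not at h
      have ha' : a = Finsupp.single j (a j) := by
        ext i
        obtain rfl | hij := eq_or_ne i j
        · simp
        · simp [h i hij, hij.symm]
      have haj : a j ≠ 0 := fun h0 => hA (by rwa [ha', h0, Finsupp.single_zero] at ha)
      refine le_trans ?_ (hterm j)
      rw [if_pos rfl, one_mul]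
      exact_mod_cast hmin _ (Nat.one_le_iff_ne_zero.mpr haj) (ha' ▸ ha)

/-- for `n ≥ 2` and `A` with variety `{0}`, the ideal generated by the
monomials with exponents in `n • Γ⁺(A)` (the integral closure of `(X^A)ⁿ`) is strictly
contained in `⋂_{B essential} (X₁^{α₁^B},…,Xₙ^{αₙ^B})` (the annihilator ideal). -/
theorem stmt10 (n : ℕ) (hn : 2 ≤ n) (A : Finset (Fin n →₀ ℕ))
    (hA : hasVarietyZero n A) :
    Ideal.span ((fun b : Fin n →₀ ℕ => (monomial b (1 : ℂ))) ''
        {b : Fin n →₀ ℕ | (fun i : Fin n => (b i : ℝ)) ∈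
          (fun x : Fin n → ℝ => (n : ℝ) • x) '' newtonPolyhedron n A}) <
      ⨅ B ∈ {B : Finset (Fin n →₀ ℕ) | essential n A B},
        Ideal.span (Set.range fun i : Fin n =>
          (X i : MvPolynomial (Fin n) ℂ) ^ ((∑ a ∈ B, a) i)) := by
  classical
  obtain ⟨h0, haxis⟩ := hA
  let j : Fin n := ⟨0, by omega⟩
  have hex := haxis j
  obtain ⟨hk1, hk⟩ := Nat.find_spec hex
  set k := Nat.find hex
  have hmin : ∀ m, 1 ≤ m → Finsupp.single j m ∈ A → k ≤ m := fun m h1 hm =>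
    Nat.find_min' hex ⟨h1, hm⟩
  refine lt_of_le_not_ge ?_ fun hle => ?_
  · refine le_iInf₂ fun B hB => Ideal.span_le.mpr ?_
    rintro _ ⟨b, hb, rfl⟩
    obtain ⟨i, hi⟩ := essential.exists_sum_le hB hb
    exact monomial_mem_span_range_X_pow hi
  · have hmem : monomial (Finsupp.single j (n * k - 1)) (1 : ℂ) ∈
        ⨅ B ∈ {B : Finset (Fin n →₀ ℕ) | essential n A B},
          Ideal.span (Set.range fun i : Fin n =>
            (X i : MvPolynomial (Fin n) ℂ) ^ ((∑ a ∈ B, a) i)) := by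
      simp only [Submodule.mem_iInf]
      intro B hB
      refine monomial_mem_span_range_X_pow (i := j) ?_
      rw [Finsupp.single_eq_same]
      exact Nat.le_sub_one_of_lt (essential.sum_apply_lt hn ⟨h0, haxis⟩ hB hk)
    obtain ⟨b, hb, hbm⟩ := mem_ideal_span_monomial_image.mp (hle hmem)
      (Finsupp.single j (n * k - 1)) (by simp [-Finsupp.single_tsub])
    have hnk := mul_le_of_le_single h0 hmin hb hbm
    have : 0 < n * k := Nat.mul_pos (by omega) hk1
    omega
end

section
/- Let n ≥ 1 and let A ⊆ ℕⁿ be a finite set with variety {0}. Let m = min{k ≥ 1 : k·e₁ ∈ A} (this set is nonempty by hypothesis). Then for every essential subset B ⊆ A, the first coordinate of α^B = Σ_{a∈B} a satisfies α₁^B ≤ n·m − (n−1). -/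
/-- A vector orthogonal to `n` linearly independent vectors of `ℝⁿ` is zero. -/
lemma eq_zero_of_forall_sum_mul_eq_zero {n : ℕ} {ι : Type*} [Fintype ι]
    (hι : Fintype.card ι = n) {v : ι → Fin n → ℝ} (hv : LinearIndependent ℝ v)
    {ρ : Fin n → ℝ} (h : ∀ j, ∑ i, ρ i * v j i = 0) : ρ = 0 := by
  have hspan : Submodule.span ℝ (Set.range v) = ⊤ :=
    hv.span_eq_top_of_card_eq_finrank' (by simpa using hι)
  have hle : Submodule.span ℝ (Set.range v) ≤ LinearMap.ker (dotProductBilin ℝ ℝ ρ) := by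
    rw [Submodule.span_le]
    rintro _ ⟨j, rfl⟩
    exact h j
  have hρ : ρ ∈ LinearMap.ker (dotProductBilin ℝ ℝ ρ) := hle (hspan ▸ Submodule.mem_top)
  exact dotProduct_self_eq_zero.mp hρ

/-- The weights of a supporting hyperplane through an essential subset are positive. -/
lemma weight_pos_of_supporting {n : ℕ} (hn : 1 ≤ n) {A B : Finset (Fin n →₀ ℕ)}
    (hA : hasVarietyZero n A) (hcard : B.card = n)
    (hlin : LinearIndependent ℝ (fun b : B => fun i : Fin n => ((b : Fin n →₀ ℕ) i : ℝ)))
    {ρ : Fin n → ℝ} (hρ : ∀ i, 0 ≤ ρ i) (hρ0 : ρ ≠ 0) {c : ℝ}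
    (hB : ∀ b ∈ B, ∑ i, ρ i * (b i : ℝ) = c) (hc : ∀ a ∈ A, c ≤ ∑ i, ρ i * (a i : ℝ))
    (i : Fin n) : 0 < ρ i := by
  have hc0 : 0 ≤ c := by
    obtain ⟨b, hb⟩ : B.Nonempty := Finset.card_pos.mp (by omega)
    rw [← hB b hb]
    exact Finset.sum_nonneg fun i _ => mul_nonneg (hρ i) (Nat.cast_nonneg _)
  have hcne : c ≠ 0 := by
    rintro rfl
    exact hρ0 (eq_zero_of_forall_sum_mul_eq_zero (by simpa using hcard) hlin
      fun b => hB b b.2)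
  obtain ⟨k, -, hk⟩ := hA.2 i
  have h := hc _ hk
  simp only [Finsupp.single_apply, Nat.cast_ite, Nat.cast_zero, mul_ite, mul_zero,
    Finset.sum_ite_eq, Finset.mem_univ, if_true] at h
  refine (hρ i).lt_of_ne fun h0 => ?_
  rw [← h0, zero_mul] at h
  exact hcne (le_antisymm h hc0)

/-- If a vector has weight at most that of `m · eⱼ`, then its `j`-th coordinate is less than `m`
unless the vector is `m · eⱼ` itself. -/
lemma apply_lt_or_eq_single {n : ℕ} {ρ : Fin n → ℝ} (hρ : ∀ i, 0 < ρ i) {b : Fin n →₀ ℕ}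
    {j : Fin n} {m : ℕ} (h : ∑ i, ρ i * (b i : ℝ) ≤ ρ j * m) :
    b j < m ∨ b = Finsupp.single j m := by
  rw [or_iff_not_imp_left, not_lt]
  intro hm
  rw [← Finset.add_sum_erase _ _ (Finset.mem_univ j)] at h
  have hnonneg : ∀ i ∈ Finset.univ.erase j, 0 ≤ ρ i * (b i : ℝ) :=
    fun i _ => mul_nonneg (hρ i).le (Nat.cast_nonneg _)
  have hmul : ρ j * m ≤ ρ j * b j :=
    mul_le_mul_of_nonneg_left (Nat.cast_le.mpr hm) (hρ j).le
  have hsum := Finset.sum_nonneg hnonneg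
  have hzero := (Finset.sum_eq_zero_iff_of_nonneg hnonneg).mp (by linarith)
  have hbm : b j = m :=
    le_antisymm (Nat.cast_le.mp (le_of_mul_le_mul_left (by linarith) (hρ j))) hm
  ext i
  by_cases hij : i = j
  · subst hij
    simpa using hbm
  · have := hzero i (by simp [hij])
    rw [Finsupp.single_eq_of_ne hij]
    simpa [(hρ i).ne'] using this

/-- if `m` is the least `k ≥ 1` with `k·e₁ ∈ A`, then for every essential
subset `B ⊆ A` the first coordinate of `α^B = Σ_{a∈B} a` is at most `n·m − (n−1)`. -/
theorem stmt11 (n : ℕ) (hn : 1 ≤ n) (A : Finset (Fin n →₀ ℕ))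
    (hA : hasVarietyZero n A) (i0 : Fin n) (hi0 : i0 = ⟨0, hn⟩)
    (m : ℕ) (hm1 : 1 ≤ m) (hmA : Finsupp.single i0 m ∈ A)
    (hmin : ∀ k : ℕ, 1 ≤ k → Finsupp.single i0 k ∈ A → m ≤ k) :
    ∀ B : Finset (Fin n →₀ ℕ), essential n A B →
      (∑ a ∈ B, a) i0 ≤ n * m - (n - 1) := by
  rintro B ⟨hBA, hcard, hlin, ρ, hρ, hρ0, c, hB, hc⟩
  have hpos := weight_pos_of_supporting hn hA hcard hlin hρ hρ0 hB hc
  have hm := hc _ hmA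
  simp only [Finsupp.single_apply, Nat.cast_ite, Nat.cast_zero, mul_ite, mul_zero,
    Finset.sum_ite_eq, Finset.mem_univ, if_true] at hm
  have hb : ∀ b ∈ B, b i0 ≤ (m - 1) + if b = Finsupp.single i0 m then 1 else 0 := by
    intro b hb
    rcases apply_lt_or_eq_single hpos ((hB b hb).trans_le hm) with h | h
    · omega
    · simp only [h, Finsupp.single_eq_same, if_true]
      omega
  have hsum := Finset.sum_le_sum hb
  rw [Finset.sum_add_distrib, Finset.sum_const, hcard, smul_eq_mul, Finset.sum_ite_eq'] at hsum
  have hone : (if Finsupp.single i0 m ∈ B then 1 else 0) ≤ 1 := by split_ifs <;> simp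
  rw [Finsupp.finsetSum_apply]
  have hnm : n * (m - 1) + n = n * m := by
    rw [← Nat.mul_succ, Nat.succ_eq_add_one, Nat.sub_add_cancel hm1]
  omega
end

section
/- Let n ≥ 1 and let A ⊆ ℕⁿ be a finite set with variety {0}. In ℂ[X₁,…,Xₙ], let I = (X^A) be the ideal generated by {X^a : a ∈ A} and let J = ⋂_{B essential subset of A} (X₁^{α₁^B}, …, Xₙ^{αₙ^B}), where α^B = Σ_{a∈B} a. Then J = I if and only if there exist integers c₁,…,cₙ ≥ 1 such that I = (X₁^{c₁},…,Xₙ^{cₙ}). (This is the combinatorial form, obtained via the main theorem, of the statement that the annihilator of the Bochner–Martinelli residue current of z^A equals (z^A) if and only if (z^A) can be generated by a complete intersection.) -/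
open MvPolynomial

section PurePowers

variable {n : ℕ}

theorem span_range_X_pow_eq_span_monomial (c : Fin n → ℕ) :
    Ideal.span (Set.range fun i : Fin n => (X i : MvPolynomial (Fin n) ℂ) ^ (c i)) =
      Ideal.span ((fun a : Fin n →₀ ℕ => (monomial a (1 : ℂ))) ''
        Set.range fun i => Finsupp.single i (c i)) := by
  rw [← Set.range_comp]
  simp only [X_pow_eq_monomial, Function.comp_def]

theorem monomial_mem_span_monomial_iff (S : Set (Fin n →₀ ℕ)) (a : Fin n →₀ ℕ) :
    monomial a (1 : ℂ) ∈ Ideal.span ((fun a : Fin n →₀ ℕ => (monomial a (1 : ℂ))) '' S) ↔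
      ∃ s ∈ S, s ≤ a := by
  classical
  simp [mem_ideal_span_monomial_image, support_monomial]

theorem monomial_mem_span_X_pow_iff (c : Fin n → ℕ) (a : Fin n →₀ ℕ) :
    monomial a (1 : ℂ) ∈
        Ideal.span (Set.range fun i : Fin n => (X i : MvPolynomial (Fin n) ℂ) ^ (c i)) ↔
      ∃ i, c i ≤ a i := by
  rw [span_range_X_pow_eq_span_monomial, monomial_mem_span_monomial_iff]
  simp

theorem span_monomial_ne_top {S : Set (Fin n →₀ ℕ)} (hS : 0 ∉ S) :
    Ideal.span ((fun a : Fin n →₀ ℕ => (monomial a (1 : ℂ))) '' S) ≠ ⊤ := by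
  intro h
  have h1 : monomial (0 : Fin n →₀ ℕ) (1 : ℂ) ∈
      Ideal.span ((fun a : Fin n →₀ ℕ => (monomial a (1 : ℂ))) '' S) := by
    rw [h]; trivial
  obtain ⟨s, hs, hle⟩ := (monomial_mem_span_monomial_iff S 0).1 h1
  obtain rfl : s = 0 := le_antisymm hle (by simp)
  exact hS hs

/-- A linear functional vanishing on `n` independent vectors of `ℝⁿ` is zero. -/
theorem eq_zero_of_vanishes_on_independent {B : Finset (Fin n →₀ ℕ)} (hcard : B.card = n)
    (hB : LinearIndependent ℝ (fun b : B => fun i : Fin n => ((b : Fin n →₀ ℕ) i : ℝ)))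
    {ρ : Fin n → ℝ} (h : ∀ b ∈ B, ∑ i, ρ i * (b i : ℝ) = 0) : ρ = 0 := by
  have hspan := hB.span_eq_top_of_card_eq_finrank' (by simp [hcard])
  have hzero : dotProductBilin ℝ ℝ ρ = 0 := by
    refine LinearMap.ext_on_range hspan fun b => ?_
    simpa [dotProduct] using h b b.2
  funext i
  simpa using LinearMap.congr_fun hzero (Pi.single i 1)

variable {A B : Finset (Fin n →₀ ℕ)}

theorem essential.exists_apply_pos (hB : essential n A B) (i : Fin n) : ∃ b ∈ B, 0 < b i := by
  obtain ⟨-, hcard, hli, -⟩ := hB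
  by_contra! h
  have := eq_zero_of_vanishes_on_independent hcard hli (ρ := Pi.single i 1) fun b hb => by
    simpa [Pi.single_apply] using h b hb
  simpa using congrFun this i

/-- If no element of an essential set `B` lies strictly below `∑ a ∈ B, a`, then `B` consists
of one point on each axis. -/
theorem essential.exists_single_mem (hB : essential n A B)
    (h : ∀ b ∈ B, ∃ i, (∑ a ∈ B, a) i ≤ b i) (i : Fin n) :
    Finsupp.single i ((∑ a ∈ B, a) i) ∈ B := by
  choose f hf using fun b : B => h b b.2
  have hother : ∀ b : B, ∀ b' : B, b' ≠ b → (b' : Fin n →₀ ℕ) (f b) = 0 := by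
    intro b b' hne
    have hsum := hf b
    rw [Finsupp.finsetSum_apply, ← Finset.add_sum_erase B _ b.2] at hsum
    have hle := Finset.single_le_sum (f := fun a : Fin n →₀ ℕ => a (f b))
      (fun _ _ => Nat.zero_le _)
      (Finset.mem_erase.2 ⟨fun e => hne (Subtype.ext e), b'.2⟩)
    omega
  have hinj : Function.Injective f := by
    intro b b' hbb
    by_contra hne
    obtain ⟨x, hx, hpos⟩ := hB.exists_apply_pos (f b)
    by_cases hxb : (⟨x, hx⟩ : B) = b
    · have := hother b' b hne
      rw [← hbb, ← hxb] at this
      exact hpos.ne' (by simpa [hxb] using this)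
    · exact hpos.ne' (hother b ⟨x, hx⟩ hxb)
  have hsurj : Function.Surjective f :=
    ((Fintype.bijective_iff_injective_and_card f).2 ⟨hinj, by simp [hB.2.1]⟩).2
  obtain ⟨b, rfl⟩ := hsurj i
  have hb : (b : Fin n →₀ ℕ) = Finsupp.single (f b) ((∑ a ∈ B, a) (f b)) := by
    ext j
    obtain ⟨b', rfl⟩ := hsurj j
    by_cases hbb : b = b'
    · subst hbb
      rw [Finsupp.single_eq_same]
      refine le_antisymm ?_ (hf b)
      simp only [Finsupp.finsetSum_apply]
      exact Finset.single_le_sum (f := fun a : Fin n →₀ ℕ => a (f b))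
        (fun _ _ => Nat.zero_le _) b.2
    · rw [hother b' b hbb, Finsupp.single_eq_of_ne fun e => hbb (hinj e).symm]
  rw [← hb]
  exact b.2

theorem essential.supporting_functional_pos (hB : essential n A B) (hA : hasVarietyZero n A) :
    ∃ ρ : Fin n → ℝ, (∀ i, 0 < ρ i) ∧ ∃ c : ℝ,
      (∀ b ∈ B, ∑ i, ρ i * (b i : ℝ) = c) ∧ ∀ a ∈ A, c ≤ ∑ i, ρ i * (a i : ℝ) := by
  obtain ⟨-, hcard, hli, ρ, hρ, hne, c, hc, hle⟩ := hB
  obtain ⟨i₀, -⟩ := Function.ne_iff.1 hne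
  have hBne : B.Nonempty := Finset.card_pos.1 (hcard.symm ▸ i₀.pos)
  obtain ⟨b, hb⟩ := hBne
  have hc0 : 0 ≤ c := hc b hb ▸ Finset.sum_nonneg fun i _ => mul_nonneg (hρ i) (Nat.cast_nonneg _)
  have hcpos : 0 < c := hc0.lt_of_ne' fun h0 =>
    hne (eq_zero_of_vanishes_on_independent hcard hli fun b hb => (hc b hb).trans h0)
  refine ⟨ρ, fun i => (hρ i).lt_of_ne' fun h0 => ?_, c, hc, hle⟩
  obtain ⟨k, -, hk⟩ := hA.2 i
  have := hle _ hk
  simp [Finsupp.single_apply, h0] at this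
  linarith

theorem single_injective_of_pos {c : Fin n → ℕ} (hc : ∀ i, 1 ≤ c i) :
    Function.Injective fun i => Finsupp.single i (c i) := by
  intro i j hij
  have := hc i
  exact ((Finsupp.single_eq_single_iff _ _ _ _).1 hij).elim (·.1) fun h => by omega

theorem essential_image_single {c : Fin n → ℕ} (hn : 1 ≤ n) (hc : ∀ i, 1 ≤ c i)
    (hmem : ∀ i, Finsupp.single i (c i) ∈ A) (hA : ∀ a ∈ A, ∃ i, c i ≤ a i) :
    essential n A (Finset.univ.image fun i => Finsupp.single i (c i)) := by
  have hpos : ∀ i, (0 : ℝ) < c i := fun i => by exact_mod_cast hc i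
  refine ⟨?_, ?_, ?_, fun i => (c i : ℝ)⁻¹, fun i => by positivity, ?_, 1, ?_, ?_⟩
  · simpa [Finset.image_subset_iff] using hmem
  · simp [Finset.card_image_of_injective _ (single_injective_of_pos hc)]
  · rw [Fintype.linearIndependent_iff]
    rintro g hg ⟨b, hb⟩
    obtain ⟨i, -, rfl⟩ := Finset.mem_image.1 hb
    have hi := congrFun hg i
    rw [Finset.sum_apply, Finset.sum_eq_single ⟨_, hb⟩] at hi
    · simpa [(hpos i).ne'] using hi
    · rintro ⟨b', hb'⟩ - hne
      obtain ⟨j, -, rfl⟩ := Finset.mem_image.1 hb'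
      have hij : i ≠ j := by rintro rfl; exact hne rfl
      simp [hij]
    · simp
  · intro h
    exact (inv_pos.2 (hpos ⟨0, hn⟩)).ne' (congrFun h ⟨0, hn⟩)
  · intro b hb
    obtain ⟨i, -, rfl⟩ := Finset.mem_image.1 hb
    simp [Finsupp.single_apply, (hpos i).ne']
  · intro a ha
    obtain ⟨i, hi⟩ := hA a ha
    calc (1 : ℝ) ≤ (c i : ℝ)⁻¹ * a i := by
          rw [inv_mul_eq_div, one_le_div (hpos i)]; exact_mod_cast hi
      _ ≤ _ := Finset.single_le_sum (f := fun i => (c i : ℝ)⁻¹ * (a i : ℝ))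
          (fun j _ => by positivity) (Finset.mem_univ i)

theorem essential.eq_image_single {c : Fin n → ℕ} (hB : essential n A B)
    (hA : hasVarietyZero n A) (hc : ∀ i, 1 ≤ c i)
    (hmem : ∀ i, Finsupp.single i (c i) ∈ A) (hle : ∀ a ∈ A, ∃ i, c i ≤ a i) :
    B = Finset.univ.image fun i => Finsupp.single i (c i) := by
  refine Finset.eq_of_subset_of_card_le (fun b hb => ?_) ?_
  · obtain ⟨ρ, hρ, d, hd, hdA⟩ := hB.supporting_functional_pos hA
    obtain ⟨i, hi⟩ := hle b (hB.1 hb)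
    have hsb : ∀ j, Finsupp.single i (c i) j ≤ b j := Finsupp.single_le_iff.2 hi
    refine Finset.mem_image.2 ⟨i, Finset.mem_univ i, ?_⟩
    by_contra hne
    obtain ⟨j, hj⟩ := Finsupp.ne_iff.1 hne
    have hlt : ∑ j, ρ j * (Finsupp.single i (c i) j : ℝ) < ∑ j, ρ j * (b j : ℝ) :=
      Finset.sum_lt_sum
        (fun j _ => mul_le_mul_of_nonneg_left (by exact_mod_cast hsb j) (hρ j).le)
        ⟨j, Finset.mem_univ j,
          mul_lt_mul_of_pos_left (by exact_mod_cast (hsb j).lt_of_ne hj) (hρ j)⟩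
    exact absurd (hdA _ (hmem i)) (not_le.2 (hd b hb ▸ hlt))
  · rw [Finset.card_image_of_injective _ (single_injective_of_pos hc), hB.2.1]
    simp

end PurePowers

/-- `⋂_{B essential} (X₁^{α₁^B},…,Xₙ^{αₙ^B}) = (X^A)` iff `(X^A)` is
generated by pure powers `X₁^{c₁},…,Xₙ^{cₙ}` (a complete intersection). -/
theorem stmt12 (n : ℕ) (hn : 1 ≤ n) (A : Finset (Fin n →₀ ℕ))
    (hA : hasVarietyZero n A) :
    (⨅ B ∈ {B : Finset (Fin n →₀ ℕ) | essential n A B},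
        Ideal.span (Set.range fun i : Fin n =>
          (X i : MvPolynomial (Fin n) ℂ) ^ ((∑ a ∈ B, a) i))) =
      Ideal.span ((fun a : Fin n →₀ ℕ => (monomial a (1 : ℂ))) '' (A : Set (Fin n →₀ ℕ))) ↔
    ∃ c : Fin n → ℕ, (∀ i, 1 ≤ c i) ∧
      Ideal.span ((fun a : Fin n →₀ ℕ => (monomial a (1 : ℂ))) '' (A : Set (Fin n →₀ ℕ))) =
        Ideal.span (Set.range fun i : Fin n =>
          (X i : MvPolynomial (Fin n) ℂ) ^ (c i)) := by
  constructor
  · intro hJ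
    have hex : ∃ B, essential n A B := by
      by_contra! h
      refine span_monomial_ne_top (S := (A : Set (Fin n →₀ ℕ))) (by simpa using hA.1) ?_
      rw [← hJ]
      simp [h]
    obtain ⟨B, hB⟩ := hex
    have hle : ∀ a ∈ A, ∃ i, (∑ b ∈ B, b) i ≤ a i := fun a ha => by
      rw [← monomial_mem_span_X_pow_iff fun i => (∑ b ∈ B, b) i]
      refine (hJ ▸ iInf₂_le B hB :
        Ideal.span ((fun a : Fin n →₀ ℕ => (monomial a (1 : ℂ))) '' (A : Set (Fin n →₀ ℕ))) ≤ _) ?_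
      exact Ideal.subset_span ⟨a, ha, rfl⟩
    refine ⟨fun i => (∑ b ∈ B, b) i, fun i => ?_, le_antisymm ?_ ?_⟩
    · obtain ⟨b, hb, hpos⟩ := hB.exists_apply_pos i
      simp only [Finsupp.finsetSum_apply]
      exact hpos.trans_le (Finset.single_le_sum (f := fun a : Fin n →₀ ℕ => a i)
        (fun _ _ => Nat.zero_le _) hb)
    · rw [Ideal.span_le]
      rintro _ ⟨a, ha, rfl⟩
      exact (monomial_mem_span_X_pow_iff _ _).2 (hle a ha)
    · rw [Ideal.span_le]
      rintro _ ⟨i, rfl⟩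
      refine Ideal.subset_span ⟨_, hB.1 (hB.exists_single_mem (fun b hb => hle b (hB.1 hb)) i), ?_⟩
      simp only [X_pow_eq_monomial]
  · rintro ⟨c, hc, hI⟩
    have hle : ∀ a ∈ A, ∃ i, c i ≤ a i := fun a ha => by
      rw [← monomial_mem_span_X_pow_iff, ← hI]
      exact Ideal.subset_span ⟨a, ha, rfl⟩
    have hmem : ∀ i, Finsupp.single i (c i) ∈ A := fun i => by
      have h := (monomial_mem_span_X_pow_iff c (Finsupp.single i (c i))).2 ⟨i, by simp⟩
      rw [← hI, monomial_mem_span_monomial_iff] at h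
      obtain ⟨a, ha, hai⟩ := h
      obtain ⟨j, hj⟩ := hle a ha
      have hij : i = j := by
        by_contra hij
        have h1 := hj.trans (hai j)
        rw [Finsupp.single_eq_of_ne' hij] at h1
        have := hc j
        omega
      subst hij
      rwa [← le_antisymm hai (Finsupp.single_le_iff.2 hj)]
    have hB := essential_image_single hn hc hmem hle
    have hsum : ∀ i, (∑ a ∈ Finset.univ.image fun i => Finsupp.single i (c i), a) i = c i :=
      fun i => by
        rw [Finset.sum_image fun x _ y _ h => single_injective_of_pos hc h]
        simp [Finsupp.finsetSum_apply, Finsupp.single_apply]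
    rw [hI]
    refine le_antisymm ((iInf₂_le _ hB).trans_eq (by simp only [hsum])) (le_iInf₂ fun B hB' => ?_)
    obtain rfl := essential.eq_image_single hB' hA hc hmem hle
    simp only [hsum, le_refl]
end

section
/- Let n ≥ 1 and let c = (c_{ij}) be an n×n complex matrix. In the exterior algebra Λ(ℂ^{2n}) over ℂ, let β₁,…,βₙ, α₁,…,αₙ denote the images under the canonical embedding ι of the 2n standard basis vectors of ℂ^{2n}. Set S = Σ_{j=1}^n αⱼ and T = Σ_{i=1}^n Σ_{j=1}^n c_{ij} βᵢ ∧ αⱼ. Then S ∧ T^{n−1} = (n−1)! · Σ_{i=1}^n (−1)^{i−1} Dᵢ · β₁ ∧ ⋯ ∧ β̂ᵢ ∧ ⋯ ∧ βₙ ∧ αₙ ∧ αₙ₋₁ ∧ ⋯ ∧ α₁, where β̂ᵢ means that βᵢ is omitted from the product, and Dᵢ is the determinant of the matrix obtained from c by replacing its i-th row by the row (1,1,…,1). -/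
open ExteriorAlgebra

section SquareZero

variable {A : Type*} [Ring A]

lemma Commute.add_pow_succ_of_mul_self_eq_zero {a b : A} (h : Commute a b) (hb : b * b = 0)
    (k : ℕ) : (a + b) ^ (k + 1) = a ^ (k + 1) + (k + 1) • (b * a ^ k) := by
  induction k with
  | zero => simp
  | succ k ih =>
    have hba : b * (b * a ^ k) = 0 := by rw [← mul_assoc, hb, zero_mul]
    have hab : a * (b * a ^ k) = b * a ^ (k + 1) := by
      rw [← mul_assoc, h.eq, mul_assoc, pow_succ']
    rw [pow_succ', ih, add_mul, mul_add, mul_add, mul_smul_comm, mul_smul_comm, hab, hba,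
      ← pow_succ', smul_zero, add_zero, succ_nsmul _ (k + 1), add_assoc]

lemma Commute.sum_pow_of_mul_self_eq_zero {n : ℕ} (x : Fin n → A)
    (hx : ∀ i j, Commute (x i) (x j)) (hx0 : ∀ i, x i * x i = 0) :
    (∑ i, x i) ^ (n + 1) = 0 ∧ (∑ i, x i) ^ n = n.factorial • (List.ofFn x).prod := by
  induction n with
  | zero => simp
  | succ n ih =>
    obtain ⟨h1, h2⟩ := ih (fun i => x i.succ) (fun _ _ => hx _ _) (fun _ => hx0 _)
    have hc : Commute (∑ i : Fin n, x i.succ) (x 0) :=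
      Commute.sum_left _ _ _ fun _ _ => hx _ _
    rw [Fin.sum_univ_succ, add_comm (x 0), hc.add_pow_succ_of_mul_self_eq_zero (hx0 0),
      hc.add_pow_succ_of_mul_self_eq_zero (hx0 0), pow_succ _ (n + 1), h1, h2]
    simp only [List.ofFn_succ, List.prod_cons, zero_mul, mul_zero, smul_zero, add_zero, zero_add,
      mul_smul_comm, smul_smul, Nat.factorial_succ, and_self]

lemma Commute.sum_pow_pred_of_mul_self_eq_zero {n : ℕ} (x : Fin (n + 1) → A)
    (hx : ∀ i j, Commute (x i) (x j)) (hx0 : ∀ i, x i * x i = 0) :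
    (∑ i, x i) ^ n = n.factorial • ∑ i : Fin (n + 1), (List.ofFn (x ∘ i.succAbove)).prod := by
  induction n with
  | zero => simp
  | succ n ih =>
    have hc : Commute (∑ i : Fin (n + 1), x i.succ) (x 0) :=
      Commute.sum_left _ _ _ fun _ _ => hx _ _
    have h2 := (Commute.sum_pow_of_mul_self_eq_zero (fun i => x i.succ) (fun _ _ => hx _ _)
      (fun _ => hx0 _)).2
    rw [Fin.sum_univ_succ, add_comm (x 0), hc.add_pow_succ_of_mul_self_eq_zero (hx0 0), h2,
      ih (fun i => x i.succ) (fun _ _ => hx _ _) (fun _ => hx0 _), Fin.sum_univ_succ (n := n + 1),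
      smul_add]
    congr 1
    rw [mul_smul_comm, Finset.mul_sum, smul_smul, Nat.factorial_succ]
    congr 1
    refine Finset.sum_congr rfl fun i _ => ?_
    rw [List.ofFn_succ, List.prod_cons]
    simp [Function.comp_def]

end SquareZero

namespace ExteriorAlgebra

variable {R M : Type*} [CommRing R] [AddCommGroup M] [Module R M]

lemma ι_mul_ι_swap (x y : M) : ι R x * ι R y = -(ι R y * ι R x) :=
  eq_neg_of_add_eq_zero_left (ι_add_mul_swap x y)

lemma commute_ι_ι_mul_ι (x y z : M) : Commute (ι R x) (ι R y * ι R z) := by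
  change _ * _ = _ * _
  rw [← mul_assoc, ι_mul_ι_swap x y, neg_mul, mul_assoc, ι_mul_ι_swap x z, mul_neg, neg_neg,
    mul_assoc]

lemma prod_ofFn_ι_mul_ι {m : ℕ} (u v : Fin m → M) :
    (List.ofFn fun k => ι R (u k) * ι R (v k)).prod =
      (List.ofFn fun k => ι R (u k)).prod * (List.ofFn fun k => ι R (v k)).reverse.prod := by
  induction m with
  | zero => simp
  | succ m ih =>
    have hc : Commute (ι R (v 0))
        (List.ofFn fun k : Fin m => ι R (u k.succ) * ι R (v k.succ)).prod :=
      Commute.list_prod_right _ _ fun x hx => by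
        obtain ⟨k, rfl⟩ := List.mem_ofFn.1 hx
        exact commute_ι_ι_mul_ι _ _ _
    rw [List.ofFn_succ, List.prod_cons, mul_assoc, hc.eq, ih]
    simp [List.ofFn_succ, mul_assoc]

lemma prod_reverse_ofFn_ι_sum_smul {m : ℕ} (c : Matrix (Fin m) (Fin m) R) (v : Fin m → M) :
    (List.ofFn fun i => ι R (∑ j, c i j • v j)).reverse.prod =
      c.det • (List.ofFn fun j => ι R (v j)).reverse.prod := by
  let f : (Fin m → R) [⋀^Fin m]→ₗ[R] ExteriorAlgebra R M :=
    (CliffordAlgebra.reverse (Q := (0 : QuadraticForm R M))).compAlternatingMap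
      ((ιMulti R m).compLinearMap (Fintype.linearCombination R v))
  have hf (w : Fin m → Fin m → R) :
      f w = (List.ofFn fun i => ι R (∑ j, w i j • v j)).reverse.prod := by
    have := CliffordAlgebra.reverse_prod_map_ι (Q := (0 : QuadraticForm R M))
      (List.ofFn fun i => ∑ j, w i j • v j)
    rw [List.map_ofFn] at this
    rw [← Function.comp_def (ι R)]
    refine Eq.trans ?_ this
    simp only [f, LinearMap.compAlternatingMap_apply, AlternatingMap.compLinearMap_apply,
      ιMulti_apply, Fintype.linearCombination_apply]
    rfl
  let b : Fin m → Fin m → R := fun i => Pi.single i 1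
  have hb : Matrix.detRowAlternating b = 1 := by
    rw [← Matrix.det_one (R := R) (n := Fin m)]
    change Matrix.det (Matrix.of b) = _
    congr 1
    ext i j
    simp [b, Matrix.one_apply, Pi.single_apply, eq_comm]
  have key : f = (LinearMap.toSpanSingleton R _ (f b)).compAlternatingMap
      Matrix.detRowAlternating := by
    refine Module.Basis.ext_alternating (Pi.basisFun R (Fin m)) fun σ hσ => ?_
    let e := Equiv.ofBijective σ (Finite.injective_iff_bijective.1 hσ)
    have he : (fun i => Pi.basisFun R (Fin m) (σ i)) = b ∘ e := by
      ext i j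
      simp [e, b]
    rw [he, AlternatingMap.map_perm, AlternatingMap.map_perm]
    congr 1
    exact (by rw [hb, one_smul] : f b = Matrix.detRowAlternating b • f b)
  have hv (i : Fin m) : ∑ j, b i j • v j = v i := by
    simp [b, Pi.single_apply]
  have h : f c = c.det • f b := congrArg (fun g => g c) key
  simp only [hf b, hv] at h
  exact (hf c).symm.trans h

end ExteriorAlgebra

lemma Matrix.det_vecCons_succAbove {R : Type*} [CommRing R] {m : ℕ}
    (c : Matrix (Fin (m + 1)) (Fin (m + 1)) R) (i : Fin (m + 1)) (r : Fin (m + 1) → R) :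
    (Matrix.of (Fin.cons r (c ∘ i.succAbove) : Fin (m + 1) → Fin (m + 1) → R)).det =
      (-1) ^ (i : ℕ) * (c.updateRow i r).det := by
  rw [Matrix.det_succ_row_zero, Matrix.det_succ_row _ i, Finset.mul_sum]
  refine Finset.sum_congr rfl fun j _ => ?_
  have h : (Matrix.of (Fin.cons r (c ∘ i.succAbove) : Fin (m + 1) → Fin (m + 1) → R)).submatrix
      Fin.succ j.succAbove = (c.updateRow i r).submatrix i.succAbove j.succAbove := by
    ext k l
    simp [Matrix.updateRow_apply, Function.comp_apply (f := c)]
  have h1 : ((-1 : R) ^ (i : ℕ)) * (-1) ^ (i : ℕ) = 1 := by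
    rw [← mul_pow]; simp
  rw [h, pow_add]
  simp only [Matrix.of_apply, Fin.cons_zero, Matrix.updateRow_self]
  linear_combination (-(-1) ^ (j : ℕ) * r j *
    ((c.updateRow i r).submatrix i.succAbove j.succAbove).det) * h1

lemma Fin.sort_univ_erase {m : ℕ} (i : Fin (m + 1)) :
    (Finset.univ.erase i).sort (· ≤ ·) = List.ofFn i.succAbove := by
  have hs := (Fin.strictMono_succAbove i).sortedLT_ofFn
  rw [← (List.toFinset_sort (· ≤ ·) hs.nodup).2 hs.sortedLE.pairwise]
  congr 1
  ext j
  simp only [Finset.mem_erase, Finset.mem_univ, and_true, List.mem_toFinset, List.mem_ofFn,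
    Fin.exists_succAbove_eq_iff]

/-- with `S = Σⱼ αⱼ` and `T = Σᵢⱼ cᵢⱼ βᵢ∧αⱼ` in the exterior algebra of
`ℂ^{2n}` (first `n` basis vectors mapped to `β₁,…,βₙ`, last `n` to `α₁,…,αₙ`),
`S ∧ T^{n−1} = (n−1)! Σᵢ (−1)^{i−1} Dᵢ β₁∧⋯∧β̂ᵢ∧⋯∧βₙ∧αₙ∧⋯∧α₁`, where `Dᵢ` is the
determinant of `c` with its `i`-th row replaced by `(1,…,1)`. -/
theorem stmt14 (n : ℕ) (hn : 1 ≤ n) (c : Matrix (Fin n) (Fin n) ℂ)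
    (β α : Fin n → ExteriorAlgebra ℂ ((Fin n ⊕ Fin n) → ℂ))
    (hβ : ∀ i, β i = ExteriorAlgebra.ι ℂ (Pi.single (Sum.inl i) 1))
    (hα : ∀ j, α j = ExteriorAlgebra.ι ℂ (Pi.single (Sum.inr j) 1)) :
    (∑ j, α j) * (∑ i, ∑ j, c i j • (β i * α j)) ^ (n - 1) =
      (Nat.factorial (n - 1) : ℂ) • ∑ i : Fin n,
        ((-1 : ℂ) ^ (i : ℕ) * (c.updateRow i 1).det) •
          ((((Finset.univ.erase i).sort (· ≤ ·)).map β).prod *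
            ((List.ofFn α).reverse).prod) := by
  obtain ⟨m, rfl⟩ : ∃ m, n = m + 1 := ⟨n - 1, by omega⟩
  obtain rfl : β = fun i => ι ℂ (Pi.single (Sum.inl i) 1) := funext hβ
  obtain rfl : α = fun j => ι ℂ (Pi.single (Sum.inr j) 1) := funext hα
  set u : Fin (m + 1) → (Fin (m + 1) ⊕ Fin (m + 1)) → ℂ := fun i => Pi.single (Sum.inl i) 1
  set v : Fin (m + 1) → (Fin (m + 1) ⊕ Fin (m + 1)) → ℂ := fun j => Pi.single (Sum.inr j) 1
  change (∑ j, ι ℂ (v j)) * (∑ i, ∑ j, c i j • (ι ℂ (u i) * ι ℂ (v j))) ^ m = _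
  have hS : ∑ j, ι ℂ (v j) = ι ℂ (∑ j, (1 : Fin (m + 1) → ℂ) j • v j) := by simp
  have hT : ∑ i, ∑ j, c i j • (ι ℂ (u i) * ι ℂ (v j)) =
      ∑ i, ι ℂ (u i) * ι ℂ (∑ j, c i j • v j) := by
    simp [Finset.mul_sum]
  rw [hS, hT, Commute.sum_pow_pred_of_mul_self_eq_zero
    (fun i => ι ℂ (u i) * ι ℂ (∑ j, c i j • v j))
    (fun i j => (commute_ι_ι_mul_ι _ _ _).mul_left (commute_ι_ι_mul_ι _ _ _))
    (fun i => by
      rw [mul_assoc, (commute_ι_ι_mul_ι _ _ _).eq, mul_assoc, ι_sq_zero, mul_zero, mul_zero]),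
    mul_smul_comm, Finset.mul_sum, Nat.add_sub_cancel, Nat.cast_smul_eq_nsmul]
  congr 1
  refine Finset.sum_congr rfl fun i _ => ?_
  have hc : Commute (ι ℂ (∑ j, (1 : Fin (m + 1) → ℂ) j • v j))
      (List.ofFn ((fun i => ι ℂ (u i) * ι ℂ (∑ j, c i j • v j)) ∘ i.succAbove)).prod :=
    Commute.list_prod_right _ _ fun x hx => by
      obtain ⟨k, rfl⟩ := List.mem_ofFn.1 hx
      exact commute_ι_ι_mul_ι _ _ _
  have hrev : (List.ofFn fun k => ι ℂ (∑ j, c (i.succAbove k) j • v j)).reverse.prod *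
      ι ℂ (∑ j, (1 : Fin (m + 1) → ℂ) j • v j) =
        ((-1 : ℂ) ^ (i : ℕ) * (c.updateRow i 1).det) •
          (List.ofFn fun j => ι ℂ (v j)).reverse.prod := by
    rw [← Matrix.det_vecCons_succAbove, ← prod_reverse_ofFn_ι_sum_smul, List.ofFn_succ,
      List.reverse_cons, List.prod_append, List.prod_singleton]
    rfl
  rw [hc.eq, Fin.sort_univ_erase, List.map_ofFn, ← mul_smul_comm, ← hrev, ← mul_assoc]
  congr 1
  exact prod_ofFn_ι_mul_ι (u ∘ i.succAbove) fun k => ∑ j, c (i.succAbove k) j • v j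
end

section
/- Let n ≥ 1 and let A ⊆ A' ⊆ ℕⁿ be finite sets with equal Newton polyhedra, Γ⁺(A) = Γ⁺(A'). Then every essential subset of A is also an essential subset of A'; consequently, in ℂ[X₁,…,Xₙ], ⋂_{B essential subset of A'} (X₁^{α₁^B},…,Xₙ^{αₙ^B}) ⊆ ⋂_{B essential subset of A} (X₁^{α₁^B},…,Xₙ^{αₙ^B}). (With a fixed Newton diagram, adding generators can only make the annihilator ideal smaller.) -/
open Pointwise MvPolynomial

/-- A linear functional with nonnegative coefficients which is bounded below by `c` on `A` is
bounded below by `c` on the Newton polyhedron of `A`. -/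
theorem le_of_mem_newtonPolyhedron {n : ℕ} {A : Finset (Fin n →₀ ℕ)} {ρ : Fin n → ℝ} {c : ℝ}
    (hρ : ∀ i, 0 ≤ ρ i) (hA : ∀ a ∈ A, c ≤ ∑ i, ρ i * (a i : ℝ)) {x : Fin n → ℝ}
    (hx : x ∈ newtonPolyhedron n A) : c ≤ ∑ i, ρ i * x i := by
  obtain ⟨y, hy, r, hr, rfl⟩ := Set.mem_add.mp hx
  have hconv : Convex ℝ {z : Fin n → ℝ | c ≤ ρ ⬝ᵥ z} :=
    convex_halfSpace_ge ⟨dotProduct_add ρ, fun t z => dotProduct_smul t ρ z⟩ c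
  have hsub := convexHull_min (by rintro _ ⟨a, ha, rfl⟩; exact hA a ha) hconv hy
  calc c ≤ ρ ⬝ᵥ y + ∑ i, ρ i * r i :=
        le_add_of_le_of_nonneg hsub (Finset.sum_nonneg fun i _ => mul_nonneg (hρ i) (hr i))
    _ = ∑ i, ρ i * (y + r) i := (dotProduct_add ρ y r).symm

/-- Every point of `A` lies in the Newton polyhedron of `A`. -/
theorem mem_newtonPolyhedron {n : ℕ} {A : Finset (Fin n →₀ ℕ)} {a : Fin n →₀ ℕ} (ha : a ∈ A) :
    (fun i => (a i : ℝ)) ∈ newtonPolyhedron n A :=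
  Set.mem_add.mpr ⟨_, subset_convexHull ℝ _ ⟨a, ha, rfl⟩, 0, fun _ => le_rfl, add_zero _⟩

/-- Essential subsets stay essential when points are added without changing the Newton
polyhedron. -/
theorem essential.of_newtonPolyhedron_eq {n : ℕ} {A A' B : Finset (Fin n →₀ ℕ)} (hAA' : A ⊆ A')
    (hΓ : newtonPolyhedron n A = newtonPolyhedron n A') (hB : essential n A B) :
    essential n A' B := by
  obtain ⟨hBA, hcard, hli, ρ, hρ, hρ0, c, hBc, hAc⟩ := hB
  exact ⟨hBA.trans hAA', hcard, hli, ρ, hρ, hρ0, c, hBc, fun a ha =>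
    le_of_mem_newtonPolyhedron hρ hAc (hΓ ▸ mem_newtonPolyhedron ha)⟩

/-- if `A ⊆ A'` have the same Newton polyhedron, then every essential
subset of `A` is essential for `A'`, and the intersection ideal for `A'` is contained in
the one for `A`. -/
theorem stmt18 (n : ℕ) (hn : 1 ≤ n) (A A' : Finset (Fin n →₀ ℕ)) (hAA' : A ⊆ A')
    (hΓ : newtonPolyhedron n A = newtonPolyhedron n A') :
    (∀ B : Finset (Fin n →₀ ℕ), essential n A B → essential n A' B) ∧
    (⨅ B ∈ {B : Finset (Fin n →₀ ℕ) | essential n A' B},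
        Ideal.span (Set.range fun i : Fin n =>
          (X i : MvPolynomial (Fin n) ℂ) ^ ((∑ a ∈ B, a) i))) ≤
      (⨅ B ∈ {B : Finset (Fin n →₀ ℕ) | essential n A B},
        Ideal.span (Set.range fun i : Fin n =>
          (X i : MvPolynomial (Fin n) ℂ) ^ ((∑ a ∈ B, a) i))) := by
  have h := fun B (hB : essential n A B) => hB.of_newtonPolyhedron_eq hAA' hΓ
  exact ⟨h, biInf_mono h⟩
end
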